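/- Let b ∈ (0, π], r ∈ ℕ, and let E be a 2π-periodic C^{r−1} function on ℝ with ∫_{−π}^{π} E = 0 whose r-th derivative satisfies E^{(r)}(x) = sign(x) − (1 − b/π) for x ∈ (−b, 2π−b) ∖ {0}. Then for every integer q > r, every s ∈ ℕ, and every collection Y_s ∈ 𝕐_s that contains both points −b and 0, the function E belongs to Δ^(q)(Y_s). -/

import Mathlib

noncomputable section

/-- A collection `Y_s ∈ 𝕐_s`: points `y 1 > y 2 > ⋯ > y (2s)` (decreasing in the index),
with the convention `y 0 = y (2s) + 2π`. -/
structure PtsColl (s : ℕ) where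
  y : ℕ → ℝ
  lt : ∀ i : ℕ, 1 ≤ i → i ≤ 2 * s → y i < y (i - 1)
  per : y 0 = y (2 * s) + 2 * Real.pi

/-- `f` is `q`-monotone on `[a,b]`: for `q = 1` it is nondecreasing on `[a,b]`, for `q = 2`
it is continuous and convex on `[a,b]`, and for `q ≥ 3` it is continuous on `[a,b]`,
`(q-2)`-times continuously differentiable on `(a,b)` with `f^{(q-2)}` convex on `(a,b)`. -/
def QMonotoneOn (q : ℕ) (f : ℝ → ℝ) (a b : ℝ) : Prop :=
  if q = 1 then MonotoneOn f (Set.Icc a b)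
  else if q = 2 then ContinuousOn f (Set.Icc a b) ∧ ConvexOn ℝ (Set.Icc a b) f
  else
    ContinuousOn f (Set.Icc a b) ∧
    ContDiffOn ℝ (q - 2 : ℕ) f (Set.Ioo a b) ∧
    ConvexOn ℝ (Set.Ioo a b) (iteratedDerivWithin (q - 2) f (Set.Ioo a b))

/-- `f ∈ Δ^(q)(Y_s)`: `f` is continuous, `2π`-periodic, and `(-1)^(i-1) f` is `q`-monotone
on `[y i, y (i-1)]` for each `i = 1, …, 2s`. -/
def DeltaQ (q s : ℕ) (Y : PtsColl s) (f : ℝ → ℝ) : Prop :=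
  Continuous f ∧ (∀ x : ℝ, f (x + 2 * Real.pi) = f x) ∧
  ∀ i : ℕ, 1 ≤ i → i ≤ 2 * s →
    QMonotoneOn q (fun x => (-1 : ℝ) ^ (i - 1) * f x) (Y.y i) (Y.y (i - 1))

open Set

/-- If the `n`-th derivative of a `C^n` function has constant derivative on an open interval,
then the function is smooth there and all its derivatives of order at least `n` are affine. -/
theorem contDiffOn_and_iteratedDerivWithin_affine {u v c : ℝ} (n : ℕ) (f : ℝ → ℝ)
    (hf : ContDiff ℝ n f) (hc : ∀ x ∈ Ioo u v, HasDerivAt (iteratedDeriv n f) c x) (m : ℕ) :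
    ContDiffOn ℝ (n + m : ℕ) f (Ioo u v) ∧
      ∃ α β : ℝ, EqOn (iteratedDerivWithin (n + m) f (Ioo u v)) (fun x => α * x + β)
        (Ioo u v) := by
  induction n generalizing f with
  | zero =>
    simp only [iteratedDeriv_zero, zero_add] at hc ⊢
    have hlin : ∀ x, HasDerivAt (fun x : ℝ => c * x) c x := fun x => by
      simpa using (hasDerivAt_id x).const_mul c
    obtain ⟨β, hβ⟩ := isOpen_Ioo.exists_eq_add_of_deriv_eq isPreconnected_Ioo
      (fun x hx => (hc x hx).differentiableAt.differentiableWithinAt)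
      (fun x _ => (hlin x).differentiableAt.differentiableWithinAt)
      (fun x hx => (hc x hx).deriv.trans (hlin x).deriv.symm)
    refine ⟨ContDiffOn.congr (ContDiff.contDiffOn (by fun_prop)) hβ, ?_⟩
    cases m with
    | zero => exact ⟨c, β, by simpa using hβ⟩
    | succ k =>
      have hd : EqOn (derivWithin f (Ioo u v)) (fun _ => c) (Ioo u v) := fun x hx => by
        rw [derivWithin_of_isOpen isOpen_Ioo hx, (hc x hx).deriv]
      refine ⟨0, if k = 0 then c else 0, fun x hx => ?_⟩
      rw [iteratedDerivWithin_succ', iteratedDerivWithin_congr hd hx, iteratedDerivWithin_const]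
      simp
  | succ n ih =>
    rw [Nat.cast_add_one, contDiff_succ_iff_deriv] at hf
    rw [iteratedDeriv_succ'] at hc
    obtain ⟨hcd, α, β, hαβ⟩ := ih (deriv f) hf.2.2 hc
    rw [show n + 1 + m = n + m + 1 by ring]
    refine ⟨?_, α, β, fun x hx => ?_⟩
    · rw [Nat.cast_add_one, contDiffOn_succ_iff_deriv_of_isOpen isOpen_Ioo]
      exact ⟨hf.1.differentiableOn, fun h => by simp at h, hcd⟩
    · rw [iteratedDerivWithin_succ',
        iteratedDerivWithin_congr (fun y hy => derivWithin_of_isOpen isOpen_Ioo hy) hx]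
      exact hαβ hx

theorem convexOn_of_eqOn_affine {S : Set ℝ} (hS : Convex ℝ S) {f : ℝ → ℝ} {α β : ℝ}
    (h : EqOn f (fun x => α * x + β) S) : ConvexOn ℝ S f := by
  refine ⟨hS, fun x hx y hy a b ha hb hab => le_of_eq ?_⟩
  rw [h (hS hx hy ha hb hab), h hx, h hy]
  simp only [smul_eq_mul]
  linear_combination (-β) * hab

/-- A spline piece of degree `n + 1` is `q`-monotone for every `q ≥ n + 2`, with either sign. -/
theorem qMonotoneOn_const_mul_of_hasDerivAt {u v c : ℝ} (huv : u < v) (n q : ℕ) (hq : n + 2 ≤ q)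
    (f : ℝ → ℝ) (hf : ContDiff ℝ n f)
    (hc : ∀ x ∈ Ioo u v, HasDerivAt (iteratedDeriv n f) c x) (σ : ℝ) :
    QMonotoneOn q (fun x => σ * f x) u v := by
  obtain ⟨m, rfl⟩ := Nat.exists_eq_add_of_le hq
  obtain ⟨hcd, α, β, hαβ⟩ := contDiffOn_and_iteratedDerivWithin_affine n f hf hc m
  have hcont : Continuous f := hf.continuous
  have hcont' : ContinuousOn (fun x => σ * f x) (Icc u v) := by fun_prop
  have hsub : n + 2 + m - 2 = n + m := by omega
  unfold QMonotoneOn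
  rw [if_neg (by omega)]
  split_ifs with h2
  · obtain ⟨rfl, rfl⟩ : n = 0 ∧ m = 0 := by omega
    refine ⟨hcont', convexOn_of_eqOn_affine (α := σ * α) (β := σ * β) (convex_Icc u v) ?_⟩
    simp only [add_zero, iteratedDerivWithin_zero] at hαβ
    have hcl := hαβ.closure hcont (by fun_prop)
    rw [closure_Ioo huv.ne] at hcl
    intro x hx
    simp only [hcl hx]
    ring
  · rw [hsub]
    refine ⟨hcont', contDiffOn_const.mul hcd,
      convexOn_of_eqOn_affine (α := σ * α) (β := σ * β) (convex_Ioo u v) fun x hx => ?_⟩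
    rw [iteratedDerivWithin_const_mul_field, hαβ hx]
    ring

theorem PtsColl.y_le_of_le {s : ℕ} (Y : PtsColl s) {i j : ℕ} (hij : i ≤ j) (hj : j ≤ 2 * s) :
    Y.y j ≤ Y.y i := by
  induction j, hij using Nat.le_induction with
  | base => exact le_rfl
  | succ j hij ih =>
    exact (Y.lt (j + 1) (by omega) hj).le.trans (ih (by omega))

/-- No point of the collection lies strictly between two consecutive ones. -/
theorem PtsColl.y_le_or_le_y {s : ℕ} (Y : PtsColl s) {i k : ℕ} (hi : i ≤ 2 * s)
    (hk : k ≤ 2 * s) : Y.y k ≤ Y.y i ∨ Y.y (i - 1) ≤ Y.y k := by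
  rcases le_or_gt i k with h | h
  · exact .inl (Y.y_le_of_le h hk)
  · exact .inr (Y.y_le_of_le (by omega) (by omega))

/-- **Property (2.4).** If `E` is the Eulerian-type ideal spline of order `r` with knots at
`-b` and `0` (i.e. `E^{(r)}(x) = sign x - (1 - b/π)` on `(-b, 2π-b) \ {0}`), then for every
`q > r` and every collection `Y_s` containing the points `-b` and `0`, `E ∈ Δ^(q)(Y_s)`. -/
theorem eulerian_spline_mem_DeltaQ (b : ℝ) (hb : b ∈ Set.Ioc 0 Real.pi) (r : ℕ) (hr : 1 ≤ r)
    (E : ℝ → ℝ) (hper : ∀ x : ℝ, E (x + 2 * Real.pi) = E x)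
    (hsm : ContDiff ℝ (r - 1 : ℕ) E)
    (hmean : (∫ x in (-Real.pi)..Real.pi, E x) = 0)
    (hderiv : ∀ x ∈ Set.Ioo (-b) (2 * Real.pi - b), x ≠ 0 →
      HasDerivAt (iteratedDeriv (r - 1) E) (Real.sign x - (1 - b / Real.pi)) x)
    (q : ℕ) (hq : r < q) (s : ℕ) (hs : 1 ≤ s) (Y : PtsColl s)
    (hmb : ∃ i : ℕ, 1 ≤ i ∧ i ≤ 2 * s ∧ Y.y i = -b)
    (hm0 : ∃ i : ℕ, 1 ≤ i ∧ i ≤ 2 * s ∧ Y.y i = 0) :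
    DeltaQ q s Y E := by
  have hb0 := hb.1
  obtain ⟨j, hj1, hj2, hj⟩ := hmb
  obtain ⟨k, hk1, hk2, hk⟩ := hm0
  have hpi := Real.pi_pos
  refine ⟨hsm.continuous, hper, fun i hi1 hi2 => ?_⟩
  suffices h : ∃ c : ℝ, ∀ x ∈ Ioo (Y.y i) (Y.y (i - 1)),
      HasDerivAt (iteratedDeriv (r - 1) E) c x by
    obtain ⟨c, hc⟩ := h
    exact qMonotoneOn_const_mul_of_hasDerivAt (Y.lt i hi1 hi2) (r - 1) q (by omega) E hsm hc _
  have hlow : Y.y (2 * s) ≤ Y.y i := Y.y_le_of_le hi2 le_rfl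
  have hup : Y.y (i - 1) ≤ Y.y 0 := Y.y_le_of_le (Nat.zero_le _) (by omega)
  have hlast : Y.y (2 * s) ≤ -b := hj ▸ Y.y_le_of_le hj2 le_rfl
  have hfirst : 0 ≤ Y.y 0 := hk ▸ Y.y_le_of_le (Nat.zero_le _) hk2
  have hY := Y.per
  have hpos : ∀ x ∈ Ioo 0 (2 * Real.pi - b),
      HasDerivAt (iteratedDeriv (r - 1) E) (1 - (1 - b / Real.pi)) x := fun x hx => by
    have h := hderiv x ⟨by linarith [hx.1], hx.2⟩ hx.1.ne'
    rwa [Real.sign_of_pos hx.1] at h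
  rcases Y.y_le_or_le_y hi2 hk2 with h0 | h0
  · exact ⟨_, fun x hx => hpos x ⟨by linarith [hx.1], by linarith [hx.2]⟩⟩
  rcases Y.y_le_or_le_y hi2 hj2 with h1 | h1
  · refine ⟨-1 - (1 - b / Real.pi), fun x hx => ?_⟩
    have hx0 : x < 0 := by linarith [hx.2]
    have h := hderiv x ⟨by linarith [hx.1], by linarith⟩ hx0.ne
    rwa [Real.sign_of_neg hx0] at h
  · refine ⟨1 - (1 - b / Real.pi), fun x hx => ?_⟩
    have h := (hpos (x + 2 * Real.pi)
      ⟨by linarith [hx.1], by linarith [hx.2]⟩).comp_add_const x (2 * Real.pi)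
    have hG : (fun x => iteratedDeriv (r - 1) E (x + 2 * Real.pi)) = iteratedDeriv (r - 1) E := by
      rw [← iteratedDeriv_comp_add_const, funext hper]
    rwa [hG] at h
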